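/- Let n ≥ 12 be an even integer and let T be a tree on n vertices with T not isomorphic to DC((n-4)/2, (n-4)/2, 4). Then λ₂(T) ≤ √((n - 1 - √5)/2), and equality holds if and only if T is isomorphic to DC((n-4)/2, (n-2)/2, 3). -/

import Mathlib

open scoped Classical

/-- Adjacency matrix of a simple graph on `Fin n`, over `ℝ`. -/
noncomputable def adjMat {n : ℕ} (G : SimpleGraph (Fin n)) : Matrix (Fin n) (Fin n) ℝ :=
  fun i j => if G.Adj i j then 1 else 0

/-- The eigenvalues (roots of the characteristic polynomial, with multiplicity)
of the adjacency matrix, sorted in nondecreasing order. -/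
noncomputable def eigList {n : ℕ} (G : SimpleGraph (Fin n)) : List ℝ :=
  (Matrix.charpoly (adjMat G)).roots.sort (· ≤ ·)

/-- `lam k G` is the `k`-th largest adjacency eigenvalue of `G` (so `lam 1` is `λ₁`). -/
noncomputable def lam {n : ℕ} (k : ℕ) (G : SimpleGraph (Fin n)) : ℝ :=
  (eigList G).getD (n - k) 0

/-- The double comet `DC(k1, k2, l)`: a path on `l` vertices (the vertices `0, …, l-1`),
with `k1` pendant leaves attached to the terminal vertex `0` and `k2` pendant leaves
attached to the terminal vertex `l - 1`. -/
def doubleComet (k1 k2 l : ℕ) : SimpleGraph (Fin (k1 + k2 + l)) :=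
  SimpleGraph.fromRel (fun i j =>
    ((i : ℕ) + 1 = (j : ℕ) ∧ (j : ℕ) < l) ∨
    (l ≤ (i : ℕ) ∧ (i : ℕ) < l + k1 ∧ (j : ℕ) = 0) ∨
    (l + k1 ≤ (i : ℕ) ∧ (j : ℕ) = l - 1))

/-- Degree of a vertex. -/
noncomputable def deg {n : ℕ} (G : SimpleGraph (Fin n)) (u : Fin n) : ℕ :=
  (Finset.univ.filter (fun w => G.Adj u w)).card

/-! ### Spectral part -/

/-- Quadratic form of the adjacency matrix. -/
noncomputable def qf {n : ℕ} (G : SimpleGraph (Fin n)) (x : Fin n → ℝ) : ℝ :=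
  ∑ i, ∑ j, if G.Adj i j then x i * x j else 0

theorem adjMat_herm {n : ℕ} (G : SimpleGraph (Fin n)) : (adjMat G).IsHermitian := by
  ext i j
  simp [adjMat, Matrix.conjTranspose_apply, G.adj_comm]

theorem lam_two_eq {n : ℕ} (hn : 2 ≤ n) (G : SimpleGraph (Fin n)) :
    lam 2 G = (adjMat_herm G).eigenvalues₀ ⟨1, by simp; omega⟩ := by
  set hA := adjMat_herm G
  have h1 : eigList G = (List.ofFn hA.eigenvalues₀).reverse := by
    unfold eigList
    apply List.Perm.eq_of_pairwise' (r := (· ≤ ·))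
    · exact Multiset.pairwise_sort _ _
    · rw [List.pairwise_reverse]
      have := hA.eigenvalues₀_antitone.sortedGE_ofFn
      exact this.pairwise
    · rw [← Multiset.coe_eq_coe, Multiset.sort_eq, hA.roots_charpoly_eq_eigenvalues₀,
        Fin.univ_val_map, Multiset.coe_eq_coe]
      exact (List.reverse_perm _).symm
  have hl : (List.ofFn hA.eigenvalues₀).length = n := by simp
  unfold lam
  rw [h1, List.getD_eq_getElem _ _ (by rw [List.length_reverse, hl]; omega)]
  rw [List.getElem_reverse, List.getElem_ofFn]
  congr 1
  ext
  simp only [hl]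
  omega

theorem spec_data {n : ℕ} (hn : 2 ≤ n) (G : SimpleGraph (Fin n)) :
    ∃ (e : OrthonormalBasis (Fin n) ℝ (EuclideanSpace ℝ (Fin n))) (ev : Fin n → ℝ)
      (i1 i2 : Fin n), i1 ≠ i2 ∧ (∀ i, Matrix.mulVec (adjMat G) ⇑(e i) = ev i • ⇑(e i)) ∧
      ev i2 = lam 2 G ∧ ev i2 ≤ ev i1 ∧ ∀ i, i ≠ i1 → ev i ≤ ev i2 := by
  set hA := adjMat_herm G
  let φ : Fin (Fintype.card (Fin n)) ≃ Fin n := Fintype.equivOfCardEq (Fintype.card_fin _)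
  have h0 : 0 < Fintype.card (Fin n) := by simp; omega
  have h1 : 1 < Fintype.card (Fin n) := by simp; omega
  have hev : ∀ i, hA.eigenvalues i = hA.eigenvalues₀ (φ.symm i) := fun i => rfl
  refine ⟨hA.eigenvectorBasis, hA.eigenvalues, φ ⟨0, h0⟩, φ ⟨1, h1⟩, ?_, ?_, ?_, ?_, ?_⟩
  · intro h
    have := φ.injective h
    simp at this
  · exact fun i => hA.mulVec_eigenvectorBasis i
  · rw [lam_two_eq hn, hev, Equiv.symm_apply_apply]
  · rw [hev, hev, Equiv.symm_apply_apply, Equiv.symm_apply_apply]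
    apply hA.eigenvalues₀_antitone
    simp [Fin.le_def]
  · intro i hi
    rw [hev, hev, Equiv.symm_apply_apply]
    apply hA.eigenvalues₀_antitone
    rw [Fin.le_def]
    by_contra hc
    apply hi
    rw [← Equiv.symm_apply_eq]
    ext
    simp at hc ⊢
    omega

theorem qf_eq {n : ℕ} (G : SimpleGraph (Fin n)) (x : Fin n → ℝ) :
    qf G x = x ⬝ᵥ (Matrix.mulVec (adjMat G) x) := by
  unfold qf
  simp only [dotProduct, Matrix.mulVec, adjMat, Finset.mul_sum]
  refine Finset.sum_congr rfl fun i _ => Finset.sum_congr rfl fun j _ => ?_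
  split_ifs <;> simp

theorem qf_expand {n : ℕ} (G : SimpleGraph (Fin n))
    (e : OrthonormalBasis (Fin n) ℝ (EuclideanSpace ℝ (Fin n))) (ev : Fin n → ℝ)
    (he : ∀ i, Matrix.mulVec (adjMat G) ⇑(e i) = ev i • ⇑(e i)) (c : Fin n → ℝ) :
    qf G (⇑(∑ i, c i • e i)) = ∑ i, ev i * (c i) ^ 2 ∧
      ∑ k, ((∑ i, c i • e i) k) ^ 2 = ∑ i, (c i) ^ 2 := by
  have hin : ∀ i j, (e i).ofLp ⬝ᵥ (e j).ofLp = if i = j then 1 else 0 := by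
    intro i j
    have := orthonormal_iff_ite.mp e.orthonormal j i
    rw [EuclideanSpace.inner_eq_star_dotProduct] at this
    simpa [eq_comm] using this
  have hs : (⇑(∑ i, c i • e i) : Fin n → ℝ) = ∑ i, c i • (e i).ofLp := by
    ext k; simp
  constructor
  · rw [qf_eq, hs, Matrix.mulVec_sum]
    simp only [Matrix.mulVec_smul, he, sum_dotProduct, dotProduct_sum, smul_dotProduct,
      dotProduct_smul, hin]
    simp
    refine Finset.sum_congr rfl fun i _ => by ring
  · have : ∑ k, ((∑ i, c i • e i) k) ^ 2 =
        (⇑(∑ i, c i • e i) : Fin n → ℝ) ⬝ᵥ (⇑(∑ i, c i • e i) : Fin n → ℝ) := by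
      simp only [dotProduct, pow_two]
    rw [this, hs]
    simp only [sum_dotProduct, dotProduct_sum, smul_dotProduct, dotProduct_smul, hin]
    simp
    refine Finset.sum_congr rfl fun i _ => by ring

theorem lam_le {n : ℕ} (hn : 2 ≤ n) (G : SimpleGraph (Fin n)) (w : Fin n → ℝ) (c : ℝ)
    (h : ∀ x : Fin n → ℝ, ∑ i, w i * x i = 0 → qf G x ≤ c * ∑ i, x i ^ 2) : lam 2 G ≤ c := by
  obtain ⟨e, ev, i1, i2, h12, he, hl, hle, -⟩ := spec_data hn G
  by_contra hc
  push Not at hc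
  rw [← hl] at hc
  -- coefficients
  obtain ⟨α, β, hne, hab⟩ : ∃ α β : ℝ, 0 < α ^ 2 + β ^ 2 ∧
      α * (∑ k, w k * e i1 k) + β * (∑ k, w k * e i2 k) = 0 := by
    set A := ∑ k, w k * e i1 k
    set B := ∑ k, w k * e i2 k
    by_cases hA : A = 0
    · exact ⟨1, 0, by norm_num, by simp [hA]⟩
    · refine ⟨B, -A, ?_, by ring⟩
      have := pow_pos (abs_pos.mpr hA) 2
      rw [sq_abs] at this
      nlinarith [sq_nonneg B]
  let cf : Fin n → ℝ := fun i => if i = i1 then α else if i = i2 then β else 0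
  obtain ⟨q1, q2⟩ := qf_expand G e ev he cf
  have hsum : ∀ F : Fin n → ℝ → ℝ, (∀ i, F i 0 = 0) →
      ∑ i, F i (cf i) = F i1 α + F i2 β := by
    intro F hF
    rw [← Finset.sum_subset (Finset.subset_univ {i1, i2})]
    · rw [Finset.sum_pair h12]
      simp [cf, h12.symm]
    · intro i _ hi
      simp at hi
      simp [cf, hi, hF]
  rw [hsum (fun i t => ev i * t ^ 2) (by simp)] at q1
  rw [hsum (fun i t => t ^ 2) (by simp)] at q2
  have h0 : ∑ k, w k * (∑ i, cf i • e i) k = 0 := by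
    have : ∀ k, (∑ i, cf i • e i) k = α * e i1 k + β * e i2 k := by
      intro k
      have := hsum (fun i t => t * e i k) (by simp)
      rw [← this]
      simp
    simp only [this]
    rw [← hab, Finset.mul_sum, Finset.mul_sum, ← Finset.sum_add_distrib]
    refine Finset.sum_congr rfl fun i _ => by ring
  have := h _ h0
  rw [q1, q2] at this
  have hc1 : c < ev i1 := lt_of_lt_of_le hc hle
  nlinarith [sq_nonneg α, sq_nonneg β, mul_nonneg (sub_nonneg.mpr hc1.le) (sq_nonneg α),
    mul_nonneg (sub_nonneg.mpr hle) (sq_nonneg α), mul_pos (sub_pos.mpr hc) hne]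

theorem le_lam {n : ℕ} (hn : 2 ≤ n) (G : SimpleGraph (Fin n)) (X : ℝ → ℝ → Fin n → ℝ) (c : ℝ)
    (hX : ∀ α β i, X α β i = α * X 1 0 i + β * X 0 1 i)
    (hp : ∀ α β, 0 < α ^ 2 + β ^ 2 → 0 < ∑ i, X α β i ^ 2)
    (h : ∀ α β, c * ∑ i, X α β i ^ 2 ≤ qf G (X α β)) : c ≤ lam 2 G := by
  obtain ⟨e, ev, i1, i2, h12, he, hl, hle, hmax⟩ := spec_data hn G
  obtain ⟨α, β, hne, hab⟩ : ∃ α β : ℝ, 0 < α ^ 2 + β ^ 2 ∧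
      α * (∑ k, e i1 k * X 1 0 k) + β * (∑ k, e i1 k * X 0 1 k) = 0 := by
    set A := ∑ k, e i1 k * X 1 0 k
    set B := ∑ k, e i1 k * X 0 1 k
    by_cases hA : A = 0
    · exact ⟨1, 0, by norm_num, by simp [hA]⟩
    · refine ⟨B, -A, ?_, by ring⟩
      have := pow_pos (abs_pos.mpr hA) 2
      rw [sq_abs] at this
      nlinarith [sq_nonneg B]
  have hx := h α β
  have hpos := hp α β hne
  set x := X α β with hxdef
  let y : EuclideanSpace ℝ (Fin n) := WithLp.toLp 2 x
  let cf : Fin n → ℝ := fun i => e.repr y i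
  have hy : ∑ i, cf i • e i = y := e.sum_repr y
  obtain ⟨q1, q2⟩ := qf_expand G e ev he cf
  rw [hy] at q1 q2
  have hc0 : cf i1 = 0 := by
    have : cf i1 = ∑ k, e i1 k * x k := by
      simp only [cf, OrthonormalBasis.repr_apply_apply, EuclideanSpace.inner_eq_star_dotProduct, y,
        dotProduct]
      refine Finset.sum_congr rfl fun i _ => by simp [mul_comm]
    rw [this, ← hab, Finset.mul_sum, Finset.mul_sum, ← Finset.sum_add_distrib]
    refine Finset.sum_congr rfl fun i _ => ?_
    rw [hxdef, hX]; ring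
  have hq : qf G x ≤ ev i2 * ∑ i, x i ^ 2 := by
    have e1 : qf G x = ∑ i, ev i * (cf i) ^ 2 := q1
    have e2 : ∑ i, x i ^ 2 = ∑ i, (cf i) ^ 2 := q2
    rw [e1, e2, Finset.mul_sum]
    refine Finset.sum_le_sum fun i _ => ?_
    by_cases hi : i = i1
    · rw [hi, hc0]; simp
    · exact mul_le_mul_of_nonneg_right (hmax i hi) (sq_nonneg _)
  rw [← hl]
  exact le_of_mul_le_mul_right (hx.trans hq) hpos

/-! ### Weights -/

/-- Delete all edges at a vertex. -/
def delV {n : ℕ} (G : SimpleGraph (Fin n)) (v : Fin n) : SimpleGraph (Fin n) where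
  Adj i j := G.Adj i j ∧ i ≠ v ∧ j ≠ v
  symm := ⟨fun _ _ h => ⟨h.1.symm, h.2.2, h.2.1⟩⟩
  loopless := ⟨fun i h => G.loopless.irrefl i h.1⟩

theorem qf_delV {n : ℕ} (G : SimpleGraph (Fin n)) (v : Fin n) (x : Fin n → ℝ) :
    qf G x = qf (delV G v) x + 2 * x v * ∑ j, if G.Adj v j then x j else 0 := by
  have key : ∀ i j, (if G.Adj i j then x i * x j else 0) =
      (if (delV G v).Adj i j then x i * x j else 0) +
      ((if i = v then x v * (if G.Adj v j then x j else 0) else 0) +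
       (if j = v then x v * (if G.Adj v i then x i else 0) else 0)) := by
    intro i j
    by_cases hi : i = v
    · subst hi
      by_cases hj : j = i
      · subst hj; simp [delV]
      · simp [delV, hj]
    · by_cases hj : j = v
      · subst hj
        simp [delV, hi, G.adj_comm, mul_comm]
      · simp [delV, hi, hj]
  unfold qf
  simp_rw [key, Finset.sum_add_distrib]
  simp only [Finset.sum_ite_eq', Finset.mem_univ, if_true]
  have : ∑ i, ∑ j, (if i = v then x v * (if G.Adj v j then x j else 0) else 0) =
      x v * ∑ j, if G.Adj v j then x j else 0 := by
    rw [Finset.sum_comm]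
    simp only [Finset.sum_ite_eq', Finset.mem_univ, if_true, Finset.mul_sum]
  rw [this, ← Finset.mul_sum]
  ring

theorem qf_le_weights {n : ℕ} (G : SimpleGraph (Fin n)) (w : Fin n → Fin n → ℝ) (x : Fin n → ℝ)
    (hw : ∀ i j, G.Adj i j → 2 * (x i * x j) ≤ w i j * x i ^ 2 + w j i * x j ^ 2) :
    qf G x ≤ ∑ i, (∑ j, if G.Adj i j then w i j else 0) * x i ^ 2 := by
  have h1 : 2 * qf G x ≤ ∑ i, ∑ j, ((if G.Adj i j then w i j * x i ^ 2 else 0) +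
      (if G.Adj i j then w j i * x j ^ 2 else 0)) := by
    unfold qf
    rw [Finset.mul_sum]
    refine Finset.sum_le_sum fun i _ => ?_
    rw [Finset.mul_sum]
    refine Finset.sum_le_sum fun j _ => ?_
    split_ifs with h
    · exact hw i j h
    · simp
  have h2 : ∑ i, ∑ j, (if G.Adj i j then w j i * x j ^ 2 else 0) =
      ∑ i, ∑ j, (if G.Adj i j then w i j * x i ^ 2 else 0) := by
    rw [Finset.sum_comm]
    simp only [G.adj_comm]
  have h3 : ∑ i, (∑ j, if G.Adj i j then w i j else 0) * x i ^ 2 =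
      ∑ i, ∑ j, (if G.Adj i j then w i j * x i ^ 2 else 0) := by
    refine Finset.sum_congr rfl fun i _ => ?_
    rw [Finset.sum_mul]
    refine Finset.sum_congr rfl fun j _ => ?_
    split_ifs <;> simp
  simp only [Finset.sum_add_distrib] at h1
  rw [h2] at h1
  rw [h3]
  linarith

theorem two_mul_le_of_weights {a b x y : ℝ} (ha : 0 < a) (hab : a * b = 1) :
    2 * (x * y) ≤ a * x ^ 2 + b * y ^ 2 := by
  have : a * (a * x ^ 2 + b * y ^ 2 - 2 * (x * y)) = (a * x - y) ^ 2 := by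
    linear_combination (y ^ 2) * hab
  have h2 : 0 ≤ a * x ^ 2 + b * y ^ 2 - 2 * (x * y) := by
    by_contra hc
    push Not at hc
    nlinarith [mul_neg_of_pos_of_neg ha hc, sq_nonneg (a * x - y)]
  linarith

/-- A weight certificate on a set `S` for the bound `μ`. -/
def Good {n : ℕ} (G : SimpleGraph (Fin n)) (S : Finset (Fin n)) (μ : ℝ) : Prop :=
  ∃ w : Fin n → Fin n → ℝ, (∀ i ∈ S, ∀ j, G.Adj i j → 0 < w i j ∧ w i j * w j i = 1) ∧
    ∀ i ∈ S, (∑ j, if G.Adj i j then w i j else 0) ≤ μ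

theorem Good.union {n : ℕ} {G : SimpleGraph (Fin n)} {S : Finset (Fin n)} {μ : ℝ}
    (hS : ∀ i j, G.Adj i j → (i ∈ S ↔ j ∈ S)) (h1 : Good G S μ) (h2 : Good G Sᶜ μ) :
    Good G Finset.univ μ := by
  obtain ⟨w1, a1, b1⟩ := h1
  obtain ⟨w2, a2, b2⟩ := h2
  refine ⟨fun i j => if i ∈ S then w1 i j else w2 i j, ?_, ?_⟩
  · intro i _ j hij
    have := hS i j hij
    by_cases hi : i ∈ S
    · have hj := this.mp hi
      simp only [hi, hj, if_true]
      exact a1 i hi j hij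
    · have hj : j ∉ S := fun h => hi (this.mpr h)
      simp only [hi, hj, if_false]
      exact a2 i (by simpa using hi) j hij
  · intro i _
    by_cases hi : i ∈ S
    · simp only [hi, if_true]
      exact b1 i hi
    · simp only [hi, if_false]
      exact b2 i (by simpa using hi)

theorem Good.qf_le {n : ℕ} {G : SimpleGraph (Fin n)} {μ : ℝ} (h : Good G Finset.univ μ)
    (x : Fin n → ℝ) : qf G x ≤ μ * ∑ i, x i ^ 2 := by
  obtain ⟨w, a, b⟩ := h
  refine (qf_le_weights G w x ?_).trans ?_
  · intro i j hij
    obtain ⟨p, q⟩ := a i (Finset.mem_univ _) j hij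
    exact two_mul_le_of_weights p q
  · rw [Finset.mul_sum]
    exact Finset.sum_le_sum fun i _ => mul_le_mul_of_nonneg_right (b i (Finset.mem_univ _))
      (sq_nonneg _)

/-- Neighbours as a finset. -/
noncomputable def nb {n : ℕ} (G : SimpleGraph (Fin n)) (i : Fin n) : Finset (Fin n) :=
  Finset.univ.filter (fun j => G.Adj i j)

theorem mem_nb {n : ℕ} {G : SimpleGraph (Fin n)} {i j : Fin n} : j ∈ nb G i ↔ G.Adj i j := by
  simp [nb]

theorem sum_nb {n : ℕ} (G : SimpleGraph (Fin n)) (i : Fin n) (f : Fin n → ℝ) :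
    (∑ j, if G.Adj i j then f j else 0) = ∑ j ∈ nb G i, f j := by
  simp [nb, Finset.sum_filter]

/-- Vertices other than `i` within two steps of `i`. -/
noncomputable def ball2 {n : ℕ} (G : SimpleGraph (Fin n)) (i : Fin n) : Finset (Fin n) :=
  Finset.univ.filter (fun k => k ≠ i ∧ (G.Adj i k ∨ ∃ j, G.Adj i j ∧ G.Adj j k))

theorem Good.schur {n : ℕ} {G : SimpleGraph (Fin n)} {S : Finset (Fin n)} {t : ℝ} (ht : 0 < t)
    (Y : Fin n → Prop) (hY : ∀ i j, G.Adj i j → (Y i ↔ ¬ Y j))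
    (hr : ∀ i ∈ S, Y i → ((∑ j ∈ nb G i, (nb G j).card : ℕ) : ℝ) ≤ t) : Good G S (√t) := by
  have hμ : 0 < √t := Real.sqrt_pos.mpr ht
  have hcard : ∀ i j, G.Adj i j → (0 : ℝ) < ((nb G j).card : ℝ) := by
    intro i j hij
    have : 0 < (nb G j).card := Finset.card_pos.mpr ⟨i, mem_nb.mpr hij.symm⟩
    exact_mod_cast this
  refine ⟨fun i j => if Y i then ((nb G j).card : ℝ) / √t else √t / ((nb G i).card : ℝ), ?_, ?_⟩
  · intro i _ j hij
    have h1 := hcard i j hij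
    have h2 := hcard j i hij.symm
    have := hY i j hij
    by_cases hi : Y i
    · have hj : ¬ Y j := this.mp hi
      simp only [hi, hj, if_true, if_false]
      refine ⟨by positivity, by field_simp⟩
    · have hj : Y j := by by_contra h; exact hi (this.mpr h)
      simp only [hi, hj, if_true, if_false]
      refine ⟨by positivity, by field_simp⟩
  · intro i hi
    rw [sum_nb]
    by_cases hy : Y i
    · simp only [hy, if_true]
      rw [← Finset.sum_div, div_le_iff₀ hμ, Real.mul_self_sqrt ht.le]
      have := hr i hi hy
      push_cast at this
      exact this
    · simp only [hy, if_false, Finset.sum_const, nsmul_eq_mul]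
      by_cases h0 : ((nb G i).card : ℝ) = 0
      · rw [h0]; simp
      · rw [mul_div_cancel₀ _ h0]

theorem sum_card_le_ball2 {n : ℕ} {G : SimpleGraph (Fin n)}
    (Y : Fin n → Prop) (hY : ∀ i j, G.Adj i j → (Y i ↔ ¬ Y j))
    (h4 : ∀ i j j' k, i ≠ k → G.Adj i j → G.Adj j k → G.Adj i j' → G.Adj j' k → j = j')
    (i : Fin n) : ∑ j ∈ nb G i, (nb G j).card ≤ (ball2 G i).card := by
  rw [← Finset.card_sigma]
  refine Finset.card_le_card_of_injOn (fun p => if p.2 = i then p.1 else p.2) ?_ ?_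
  · rintro ⟨j, k⟩ h
    simp only [Finset.coe_sigma, Set.mem_sigma_iff, Finset.mem_coe, mem_nb] at h
    simp only [ball2, Finset.coe_filter, Finset.mem_univ, true_and, Set.mem_ofPred_eq]
    by_cases hk : k = i
    · simp only [hk, if_true]
      exact ⟨h.1.ne', Or.inl h.1⟩
    · simp only [hk, if_false]
      exact ⟨hk, Or.inr ⟨j, h⟩⟩
  · rintro ⟨j, k⟩ h ⟨j', k'⟩ h' heq
    simp only [Finset.coe_sigma, Set.mem_sigma_iff, Finset.mem_coe, mem_nb] at h h'
    have tri : ∀ a b c, G.Adj a b → G.Adj b c → ¬ G.Adj a c := by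
      intro a b c x y z
      have := hY _ _ x; have := hY _ _ y; have := hY _ _ z
      tauto
    by_cases hk : k = i
    · by_cases hk' : k' = i
      · simp only [hk, hk', if_true] at heq
        subst heq; simp [hk, hk']
      · simp only [hk, hk', if_true, if_false] at heq
        subst heq
        exact absurd h.1 (tri _ _ _ h'.1 h'.2)
    · by_cases hk' : k' = i
      · simp only [hk, hk', if_true, if_false] at heq
        subst heq
        exact absurd h'.1 (tri _ _ _ h.1 h.2)
      · simp only [hk, hk', if_false] at heq
        subst heq
        have := h4 i j j' k (Ne.symm hk) h.1 h.2 h'.1 h'.2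
        subst this; rfl

/-! ### Sides of an edge -/

/-- The component of `u` in `T` minus the edge `uv`. -/
noncomputable def side {n : ℕ} (T : SimpleGraph (Fin n)) (u v : Fin n) : Finset (Fin n) :=
  Finset.univ.filter (fun x => (T.deleteEdges {s(u, v)}).Reachable u x)

theorem mem_side_self {n : ℕ} (T : SimpleGraph (Fin n)) (u v : Fin n) : u ∈ side T u v := by
  simp [side]

theorem side_step {n : ℕ} {T : SimpleGraph (Fin n)} {u v x y : Fin n} (hx : x ∈ side T u v)
    (h : T.Adj x y) (hne : s(x, y) ≠ s(u, v)) : y ∈ side T u v := by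
  simp only [side, Finset.mem_filter, Finset.mem_univ, true_and] at hx ⊢
  refine hx.trans (SimpleGraph.Adj.reachable ?_)
  rw [SimpleGraph.deleteEdges_adj]
  exact ⟨h, by simpa using hne⟩

theorem reach_induct {n : ℕ} {G : SimpleGraph (Fin n)} {u x : Fin n} (P : Fin n → Prop)
    (h0 : P u) (hs : ∀ x y, P x → G.Reachable u x → G.Adj x y → P y) (hx : G.Reachable u x) :
    P x := by
  obtain ⟨p⟩ := hx
  have : ∀ (a b : Fin n) (p : G.Walk a b), P a → G.Reachable u a → P b := by
    intro a b p
    induction p with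
    | nil => exact fun h _ => h
    | cons h p ih => exact fun ha hr => ih (hs _ _ ha hr h) (hr.trans h.reachable)
  exact this _ _ p h0 (SimpleGraph.Reachable.refl _)

theorem side_induct {n : ℕ} {T : SimpleGraph (Fin n)} {u v : Fin n} (P : Fin n → Prop)
    (h0 : P u) (hs : ∀ x y, P x → x ∈ side T u v → T.Adj x y → s(x, y) ≠ s(u, v) → P y)
    {x : Fin n} (hx : x ∈ side T u v) : P x := by
  simp only [side, Finset.mem_filter, Finset.mem_univ, true_and] at hx hs
  refine reach_induct P h0 ?_ hx
  intro x y px hr ha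
  rw [SimpleGraph.deleteEdges_adj] at ha
  exact hs x y px hr ha.1 (by simpa using ha.2)

theorem not_mem_side {n : ℕ} {T : SimpleGraph (Fin n)} (hT : T.IsTree) {u v : Fin n}
    (h : T.Adj u v) : v ∉ side T u v := by
  have := SimpleGraph.isAcyclic_iff_forall_adj_isBridge.mp hT.isAcyclic h
  rw [SimpleGraph.isBridge_iff] at this
  simpa [side] using this

theorem side_compl {n : ℕ} {T : SimpleGraph (Fin n)} (hT : T.IsTree) {u v : Fin n}
    (h : T.Adj u v) : side T v u = (side T u v)ᶜ := by
  have h1 : ∀ x, x ∈ side T u v ∨ x ∈ side T v u := by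
    intro x
    refine reach_induct (G := T) (u := u) (fun x => x ∈ side T u v ∨ x ∈ side T v u) ?_ ?_
      (hT.connected.preconnected u x)
    · exact Or.inl (mem_side_self _ _ _)
    · intro x y hx _ hxy
      by_cases hne : s(x, y) = s(u, v)
      · rw [Sym2.eq_iff] at hne
        rcases hne with ⟨rfl, rfl⟩ | ⟨rfl, rfl⟩
        · exact Or.inr (mem_side_self _ _ _)
        · exact Or.inl (mem_side_self _ _ _)
      · rcases hx with hx | hx
        · exact Or.inl (side_step hx hxy hne)
        · exact Or.inr (side_step hx hxy (by rwa [Sym2.eq_swap (a := v)]))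
  have h2 : ∀ x, x ∈ side T u v → x ∉ side T v u := by
    intro x hx hx'
    have := not_mem_side hT h
    simp only [side, Finset.mem_filter, Finset.mem_univ, true_and] at hx hx' this
    rw [Sym2.eq_swap] at hx'
    exact this (hx.trans hx'.symm)
  ext x
  rw [Finset.mem_compl]
  constructor
  · intro hx hx'
    exact h2 x hx' hx
  · intro hx
    exact (h1 x).resolve_left hx

theorem side_card {n : ℕ} {T : SimpleGraph (Fin n)} (hT : T.IsTree) {u v : Fin n}
    (h : T.Adj u v) : (side T v u).card + (side T u v).card = n := by
  rw [side_compl hT h, Finset.card_compl]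
  have := Finset.card_le_univ (side T u v)
  simp at this ⊢
  omega

theorem side_ssubset {n : ℕ} {T : SimpleGraph (Fin n)} (hT : T.IsTree) {u v w : Fin n}
    (h : T.Adj v u) (hw : T.Adj v w) (hne : w ≠ u) : side T w v ⊂ side T v u := by
  rw [Finset.ssubset_iff_of_subset]
  · exact ⟨v, mem_side_self _ _ _, not_mem_side hT hw.symm⟩
  · intro x hx
    refine side_induct (T := T) (u := w) (v := v) (fun x => x ∈ side T v u) ?_ ?_ hx
    · refine side_step (mem_side_self _ _ _) hw ?_
      intro hh
      rw [Sym2.eq_iff] at hh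
      rcases hh with ⟨_, h2⟩ | ⟨h1, h2⟩
      · exact hne h2
      · exact hw.ne' h2
    · intro x y hx hxs hxy hn
      refine side_step hx hxy ?_
      intro hh
      have hy := side_step hxs hxy hn
      rw [Sym2.eq_iff] at hh
      rcases hh with ⟨rfl, rfl⟩ | ⟨rfl, rfl⟩
      · exact not_mem_side hT hw.symm hxs
      · exact not_mem_side hT hw.symm hy

theorem exists_side {n : ℕ} {T : SimpleGraph (Fin n)} (hT : T.IsTree) {v x : Fin n}
    (hx : x ≠ v) : ∃ w, T.Adj w v ∧ x ∈ side T w v := by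
  have : x = v ∨ ∃ w, T.Adj w v ∧ x ∈ side T w v := by
    refine reach_induct (G := T) (u := v) (fun x => x = v ∨ ∃ w, T.Adj w v ∧ x ∈ side T w v) ?_ ?_
      (hT.connected.preconnected v x)
    · exact Or.inl rfl
    · intro x y hx _ hxy
      by_cases hy : y = v
      · exact Or.inl hy
      · right
        by_cases hxv : x = v
        · subst hxv
          exact ⟨y, hxy.symm, mem_side_self _ _ _⟩
        · obtain ⟨w, hw, hxw⟩ := hx.resolve_left hxv
          refine ⟨w, hw, side_step hxw hxy ?_⟩
          intro hh
          rw [Sym2.eq_iff] at hh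
          tauto
  exact this.resolve_left hx

theorem centroid {n m : ℕ} (hm : n = 2 * m) (h1 : 1 ≤ m) {T : SimpleGraph (Fin n)} (hT : T.IsTree) :
    (∃ v, ∀ w, T.Adj w v → (side T w v).card ≤ m - 1) ∨
    (∃ u v, T.Adj u v ∧ (side T u v).card = m ∧ (side T v u).card = m) := by
  let D : Finset (Fin n × Fin n) :=
    Finset.univ.filter (fun p => T.Adj p.1 p.2 ∧ m ≤ (side T p.1 p.2).card)
  have hD : D.Nonempty := by
    have hnt : Nontrivial (Fin n) := Fin.nontrivial_iff_two_le.mpr (by omega)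
    obtain ⟨u, v, huv⟩ : ∃ u v, T.Adj u v := by
      obtain ⟨a⟩ := hT.connected.nonempty
      obtain ⟨b, hb⟩ := hT.connected.preconnected.exists_adj_of_nontrivial a
      exact ⟨a, b, hb⟩
    have := side_card hT huv
    by_cases hc : m ≤ (side T u v).card
    · exact ⟨(u, v), by simp [D, huv, hc]⟩
    · exact ⟨(v, u), by simp only [D, Finset.mem_filter, Finset.mem_univ, true_and]; exact ⟨huv.symm, by omega⟩⟩
  obtain ⟨⟨v, u⟩, hp, hmin⟩ := Finset.exists_min_image D (fun p => (side T p.1 p.2).card) hD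
  simp only [D, Finset.mem_filter, Finset.mem_univ, true_and] at hp hmin
  obtain ⟨hvu, hc⟩ := hp
  have hsum := side_card hT hvu
  by_cases he : (side T v u).card = m
  · right
    exact ⟨v, u, hvu, he, by omega⟩
  · left
    refine ⟨v, fun w hw => ?_⟩
    by_cases hwu : w = u
    · subst hwu; omega
    · have h2 := Finset.card_lt_card (side_ssubset hT hvu hw.symm hwu)
      by_contra hcon
      have := hmin (w, v) ⟨hw, by simp only; omega⟩
      simp only at this
      omega

/-- Tree: no four-cycles. -/
theorem tree_no_C4 {n : ℕ} {T : SimpleGraph (Fin n)} (hT : T.IsTree) :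
    ∀ i j j' k, i ≠ k → T.Adj i j → T.Adj j k → T.Adj i j' → T.Adj j' k → j = j' := by
  intro i j j' k hik h1 h2 h3 h4
  let p : T.Walk i k := .cons h1 (.cons h2 .nil)
  let q : T.Walk i k := .cons h3 (.cons h4 .nil)
  have hp : p.IsPath := by
    simp [p, SimpleGraph.Walk.cons_isPath_iff, h1.ne, h2.ne, hik]
  have hq : q.IsPath := by
    simp [q, SimpleGraph.Walk.cons_isPath_iff, h3.ne, h4.ne, hik]
  have := hT.isAcyclic.path_unique ⟨p, hp⟩ ⟨q, hq⟩
  have h5 : p = q := congrArg Subtype.val this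
  simp only [p, q, SimpleGraph.Walk.cons.injEq] at h5
  exact h5.1

theorem tree_color {n : ℕ} {T : SimpleGraph (Fin n)} (hT : T.IsTree) :
    ∃ Y : Fin n → Prop, ∀ i j, T.Adj i j → (Y i ↔ ¬ Y j) := by
  let C := hT.isAcyclic.coloringTwo
  refine ⟨fun i => C i = 0, fun i j hij => ?_⟩
  have := C.valid hij
  have h1 : ∀ a b : Fin 2, a ≠ b → (a = 0 ↔ ¬ b = 0) := by decide
  exact h1 _ _ this

/-! ### Deleting a vertex -/

theorem lam_le_of_good {n : ℕ} (hn : 2 ≤ n) {T : SimpleGraph (Fin n)} {v : Fin n} {μ : ℝ}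
    (h : Good (delV T v) Finset.univ μ) : lam 2 T ≤ μ := by
  refine lam_le hn T (fun i => if i = v then 1 else 0) μ ?_
  intro x hx
  have hv : x v = 0 := by simpa using hx
  rw [qf_delV T v x, hv]
  simpa using h.qf_le x

theorem delV_color {n : ℕ} {T : SimpleGraph (Fin n)} {Y : Fin n → Prop}
    (hY : ∀ i j, T.Adj i j → (Y i ↔ ¬ Y j)) (v : Fin n) :
    ∀ i j, (delV T v).Adj i j → (Y i ↔ ¬ Y j) := fun i j h => hY i j h.1

theorem delV_C4 {n : ℕ} {T : SimpleGraph (Fin n)} (hT : T.IsTree) (v : Fin n) :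
    ∀ i j j' k, i ≠ k → (delV T v).Adj i j → (delV T v).Adj j k → (delV T v).Adj i j' →
      (delV T v).Adj j' k → j = j' := fun i j j' k h a b c d =>
  tree_no_C4 hT i j j' k h a.1 b.1 c.1 d.1

theorem ball2_delV_self {n : ℕ} (T : SimpleGraph (Fin n)) (v : Fin n) :
    ball2 (delV T v) v = ∅ := by
  ext k
  simp [ball2, delV]

theorem ball2_delV_sub {n : ℕ} {T : SimpleGraph (Fin n)} {v w i : Fin n}
    (hi : i ∈ side T w v) : ball2 (delV T v) i ⊆ (side T w v).erase i := by
  have step : ∀ x y, x ∈ side T w v → (delV T v).Adj x y → y ∈ side T w v := by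
    intro x y hx hxy
    refine side_step hx hxy.1 ?_
    intro hh
    have := hxy.2
    rw [Sym2.eq_iff] at hh
    tauto
  intro k hk
  simp only [ball2, Finset.mem_filter, Finset.mem_univ, true_and] at hk
  rw [Finset.mem_erase]
  refine ⟨hk.1, ?_⟩
  rcases hk.2 with h | ⟨j, h1, h2⟩
  · exact step _ _ hi h
  · exact step _ _ (step _ _ hi h1) h2

theorem centroid_case {n m : ℕ} (hn : n = 2 * m) (hm : 6 ≤ m) {T : SimpleGraph (Fin n)}
    (hT : T.IsTree) {v : Fin n} (hv : ∀ w, T.Adj w v → (side T w v).card ≤ m - 1) :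
    lam 2 T ≤ √((m : ℝ) - 2) := by
  obtain ⟨Y, hY⟩ := tree_color hT
  have hmr : (6 : ℝ) ≤ m := by exact_mod_cast hm
  refine lam_le_of_good (v := v) (by omega) ?_
  refine Good.schur (by linarith) Y (delV_color hY v) ?_
  intro i _ _
  have h1 := sum_card_le_ball2 Y (delV_color hY v) (delV_C4 hT v) i
  have h2 : (ball2 (delV T v) i).card ≤ m - 2 := by
    by_cases hi : i = v
    · rw [hi, ball2_delV_self]; simp
    · obtain ⟨w, hw, hiw⟩ := exists_side hT hi
      have := Finset.card_le_card (ball2_delV_sub hiw)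
      rw [Finset.card_erase_of_mem hiw] at this
      have := hv w hw
      omega
  have h3 := h1.trans h2
  have : ((m - 2 : ℕ) : ℝ) = (m : ℝ) - 2 := by rw [Nat.cast_sub (by omega)]; norm_num
  rw [← this]
  exact_mod_cast h3

theorem good_double_star {n m : ℕ} (hm : 6 ≤ m) {G : SimpleGraph (Fin n)} {A : Finset (Fin n)}
    (hA : ∀ i j, G.Adj i j → (i ∈ A ↔ j ∈ A)) (hcard : A.card = m)
    {Y : Fin n → Prop} (hY : ∀ i j, G.Adj i j → (Y i ↔ ¬ Y j))
    (h4 : ∀ i j j' k, i ≠ k → G.Adj i j → G.Adj j k → G.Adj i j' → G.Adj j' k → j = j')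
    {a b : Fin n} (ha : a ∈ A) (hb : b ∈ A) (hYa : Y a) (hYb : ¬ Y b)
    (hadj_a : ∀ x ∈ A, ¬ Y x → G.Adj a x) (hadj_b : ∀ x ∈ A, Y x → G.Adj b x)
    (ha' : ∃ x ∈ A, x ≠ a ∧ Y x) (hb' : ∃ x ∈ A, x ≠ b ∧ ¬ Y x) :
    Good G A (√((m : ℝ) - 5 / 3)) := by
  have hmr : (6 : ℝ) ≤ m := by exact_mod_cast hm
  have hnba : nb G a = A.filter (fun x => ¬ Y x) := by
    ext x
    rw [mem_nb, Finset.mem_filter]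
    exact ⟨fun h => ⟨(hA _ _ h).mp ha, (hY _ _ h).mp hYa⟩, fun h => hadj_a x h.1 h.2⟩
  have hnbb : nb G b = A.filter (fun x => Y x) := by
    ext x
    rw [mem_nb, Finset.mem_filter]
    exact ⟨fun h => ⟨(hA _ _ h).mp hb, by have := hY _ _ h; tauto⟩, fun h => hadj_b x h.1 h.2⟩
  have hab : G.Adj a b := hadj_a b hb hYb
  set P := (nb G a).card with hP
  set Q := (nb G b).card with hQ
  have hPQ : P + Q = m := by
    rw [hP, hQ, hnba, hnbb, add_comm, Finset.card_filter_add_card_filter_not, hcard]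
  have hP2 : 2 ≤ P := by
    obtain ⟨x, hx, hxb, hxy⟩ := hb'
    have : ({x, b} : Finset (Fin n)) ⊆ nb G a := by
      intro y hy
      simp only [Finset.mem_insert, Finset.mem_singleton] at hy
      rw [mem_nb]
      rcases hy with rfl | rfl
      · exact hadj_a _ hx hxy
      · exact hab
    have := Finset.card_le_card this
    rwa [Finset.card_pair hxb] at this
  have hQ2 : 2 ≤ Q := by
    obtain ⟨x, hx, hxb, hxy⟩ := ha'
    have : ({x, a} : Finset (Fin n)) ⊆ nb G b := by
      intro y hy
      simp only [Finset.mem_insert, Finset.mem_singleton] at hy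
      rw [mem_nb]
      rcases hy with rfl | rfl
      · exact hadj_b _ hx hxy
      · exact hab.symm
    have := Finset.card_le_card this
    rwa [Finset.card_pair hxb] at this
  have hPr : (2 : ℝ) ≤ P := by exact_mod_cast hP2
  have hQr : (2 : ℝ) ≤ Q := by exact_mod_cast hQ2
  have hPQr : (P : ℝ) + Q = m := by exact_mod_cast hPQ
  set t : ℝ := (m : ℝ) - 5 / 3 with ht
  have htpos : 0 < t := by linarith
  set μ := √t with hμd
  have hμ : 0 < μ := Real.sqrt_pos.mpr htpos
  have hμ2 : μ * μ = t := Real.mul_self_sqrt htpos.le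
  set p : ℝ := (P : ℝ) - 1 with hp
  set q : ℝ := (Q : ℝ) - 1 with hq
  have hpt : 0 < t - p := by rw [ht, hp]; linarith
  have key : t ≤ (t - p) * (t - q) := by
    have h1 : 0 ≤ ((P : ℝ) - 2) * ((Q : ℝ) - 2) := mul_nonneg (by linarith) (by linarith)
    have hQe : (Q : ℝ) = m - P := by linarith
    rw [ht, hp, hq, hQe]
    rw [hQe] at h1
    nlinarith
  set c := (t - p) / μ with hc
  have hcpos : 0 < c := by positivity
  have hba : b ≠ a := hab.ne'
  have only : ∀ i ∈ A, ∀ j, G.Adj i j → i ≠ a → i ≠ b → j = a ∨ j = b := by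
    intro i hi j hij hia hib
    have hj : j ∈ A := (hA _ _ hij).mp hi
    have hc := hY _ _ hij
    by_cases hy : Y i
    · right
      have hny := hc.mp hy
      exact (h4 a b j i (Ne.symm hia) hab (hadj_b i hi hy) (hadj_a j hj hny) hij.symm).symm
    · left
      have hyj : Y j := by tauto
      exact (h4 b a j i (Ne.symm hib) hab.symm (hadj_a i hi hy) (hadj_b j hj hyj) hij.symm).symm
  refine ⟨fun i j => if i = a then (if j = b then c else 1 / μ) else
    if i = b then (if j = a then 1 / c else 1 / μ) else μ, ?_, ?_⟩
  · intro i hi j hij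
    by_cases hia : i = a
    · subst hia
      by_cases hjb : j = b
      · subst hjb
        simp only [if_true, hba, if_false]
        exact ⟨hcpos, by field_simp⟩
      · have hja : j ≠ i := hij.ne'
        simp only [if_true, hjb, hja, if_false]
        exact ⟨by positivity, by field_simp⟩
    · by_cases hib : i = b
      · subst hib
        by_cases hja : j = a
        · subst hja
          simp only [if_true, hba, if_false]
          exact ⟨by positivity, by field_simp⟩
        · have hjb : j ≠ i := hij.ne'
          simp only [if_true, hjb, hja, hia, if_false]
          exact ⟨by positivity, by field_simp⟩
      · rcases only i hi j hij hia hib with rfl | rfl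
        · simp only [hia, hib, if_false, if_true]
          exact ⟨hμ, by field_simp⟩
        · simp only [hia, hib, hba, if_false, if_true]
          exact ⟨hμ, by field_simp⟩
  · intro i hi
    rw [sum_nb]
    by_cases hia : i = a
    · subst hia
      simp only [if_true]
      have hbm : b ∈ nb G i := mem_nb.mpr hab
      rw [← Finset.add_sum_erase _ _ hbm]
      have : ∑ x ∈ (nb G i).erase b, (if x = b then c else 1 / μ) = p * (1 / μ) := by
        rw [Finset.sum_congr rfl (g := fun _ => 1 / μ)]
        · rw [Finset.sum_const, Finset.card_erase_of_mem hbm, nsmul_eq_mul,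
            Nat.cast_sub (by omega)]
          simp [hp, hP]
        · intro x hx
          rw [if_neg (Finset.ne_of_mem_erase hx)]
      rw [this, if_pos rfl, hc]
      have : (t - p) / μ + p * (1 / μ) = μ := by
        field_simp
        rw [pow_two, hμ2]; ring
      exact this.le
    · by_cases hib : i = b
      · subst hib
        simp only [if_true, hia, if_false]
        have ham : a ∈ nb G i := mem_nb.mpr hab.symm
        rw [← Finset.add_sum_erase _ _ ham]
        have : ∑ x ∈ (nb G i).erase a, (if x = a then 1 / c else 1 / μ) = q * (1 / μ) := by
          rw [Finset.sum_congr rfl (g := fun _ => 1 / μ)]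
          · rw [Finset.sum_const, Finset.card_erase_of_mem ham, nsmul_eq_mul,
              Nat.cast_sub (by omega)]
            simp [hq, hQ]
          · intro x hx
            rw [if_neg (Finset.ne_of_mem_erase hx)]
        rw [this, if_pos rfl, hc]
        have h1 : 1 / ((t - p) / μ) ≤ (t - q) / μ := by
          rw [one_div_div, div_le_div_iff₀ hpt hμ, hμ2]
          linarith
        have h2 : (t - q) / μ + q * (1 / μ) = μ := by
          field_simp
          rw [pow_two, hμ2]; ring
        linarith
      · simp only [hia, hib, if_false, Finset.sum_const, nsmul_eq_mul]
        have : (nb G i).card ≤ 1 := by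
          rw [Finset.card_le_one]
          intro x hx y hy
          rw [mem_nb] at hx hy
          have h1 := hY _ _ hx
          have h2 := hY _ _ hy
          rcases only i hi x hx hia hib with rfl | rfl <;>
          rcases only i hi y hy hia hib with rfl | rfl <;> tauto
        have : ((nb G i).card : ℝ) ≤ 1 := by exact_mod_cast this
        nlinarith

theorem nonstar_case {n m : ℕ} (hn : n = 2 * m) (hm : 6 ≤ m) {T : SimpleGraph (Fin n)}
    (hT : T.IsTree) {u v : Fin n} (huv : T.Adj u v) (hu : (side T u v).card = m)
    (hns : ∀ a ∈ side T u v, ∃ x ∈ side T u v, x ≠ a ∧ ¬ T.Adj a x) :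
    lam 2 T ≤ √((m : ℝ) - 5 / 3) := by
  obtain ⟨Y, hY⟩ := tree_color hT
  have hmr : (6 : ℝ) ≤ m := by exact_mod_cast hm
  refine lam_le_of_good (v := v) (by omega) ?_
  set G := delV T v with hG
  set A := side T u v with hAdef
  have hvA : v ∉ A := not_mem_side hT huv
  have step : ∀ x y, x ∈ A → G.Adj x y → y ∈ A := by
    intro x y hx hxy
    refine side_step hx hxy.1 ?_
    intro hh
    have := hxy.2
    rw [Sym2.eq_iff] at hh
    tauto
  have hA : ∀ i j, G.Adj i j → (i ∈ A ↔ j ∈ A) := fun i j h =>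
    ⟨fun hi => step _ _ hi h, fun hj => step _ _ hj h.symm⟩
  have hYG : ∀ i j, G.Adj i j → (Y i ↔ ¬ Y j) := delV_color hY v
  have hball : ∀ i, ∑ j ∈ nb G i, (nb G j).card ≤ (ball2 G i).card := sum_card_le_ball2 Y hYG (delV_C4 hT v)
  have hm2 : ((m - 2 : ℕ) : ℝ) ≤ (m : ℝ) - 5 / 3 := by
    rw [Nat.cast_sub (by omega)]; push_cast; linarith
  have fin : ∀ i, ∑ j ∈ nb G i, (nb G j).card ≤ m - 2 →
      ((∑ j ∈ nb G i, (nb G j).card : ℕ) : ℝ) ≤ (m : ℝ) - 5 / 3 := by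
    intro i hi
    refine le_trans ?_ hm2
    exact_mod_cast hi
  refine Good.union hA ?_ ?_
  · by_cases c1 : ∀ i ∈ A, Y i → ∑ j ∈ nb G i, (nb G j).card ≤ m - 2
    · exact Good.schur (by linarith) Y hYG fun i hi hy => fin i (c1 i hi hy)
    by_cases c2 : ∀ i ∈ A, ¬ Y i → ∑ j ∈ nb G i, (nb G j).card ≤ m - 2
    · refine Good.schur (by linarith) (fun i => ¬ Y i) ?_ fun i hi hy => fin i (c2 i hi hy)
      intro i j hij
      have := hYG i j hij
      tauto
    push Not at c1 c2
    obtain ⟨a, haA, hYa, hra⟩ := c1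
    obtain ⟨b, hbA, hYb, hrb⟩ := c2
    have full : ∀ i ∈ A, m - 2 < ∑ j ∈ nb G i, (nb G j).card → ball2 G i = A.erase i := by
      intro i hi hr
      refine Finset.eq_of_subset_of_card_le (ball2_delV_sub hi) ?_
      rw [Finset.card_erase_of_mem hi, hu]
      have := hball i
      omega
    have fa := full a haA hra
    have fb := full b hbA hrb
    have hadj_a : ∀ x ∈ A, ¬ Y x → G.Adj a x := by
      intro x hx hy
      have hxa : x ≠ a := fun h => hy (h ▸ hYa)
      have : x ∈ ball2 G a := by rw [fa]; exact Finset.mem_erase.mpr ⟨hxa, hx⟩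
      simp only [ball2, Finset.mem_filter, Finset.mem_univ, true_and] at this
      rcases this.2 with h | ⟨j, h1, h2⟩
      · exact h
      · have := hYG _ _ h1
        have := hYG _ _ h2
        tauto
    have hadj_b : ∀ x ∈ A, Y x → G.Adj b x := by
      intro x hx hy
      have hxa : x ≠ b := fun h => hYb (h ▸ hy)
      have : x ∈ ball2 G b := by rw [fb]; exact Finset.mem_erase.mpr ⟨hxa, hx⟩
      simp only [ball2, Finset.mem_filter, Finset.mem_univ, true_and] at this
      rcases this.2 with h | ⟨j, h1, h2⟩
      · exact h
      · have := hYG _ _ h1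
        have := hYG _ _ h2
        tauto
    refine good_double_star hm hA hu hYG (delV_C4 hT v) haA hbA hYa hYb hadj_a hadj_b ?_ ?_
    · obtain ⟨x, hx, hxa, hnx⟩ := hns a haA
      refine ⟨x, hx, hxa, ?_⟩
      by_contra h
      exact hnx (hadj_a x hx h).1
    · obtain ⟨x, hx, hxa, hnx⟩ := hns b hbA
      refine ⟨x, hx, hxa, ?_⟩
      intro h
      exact hnx (hadj_b x hx h).1
  · refine Good.schur (by linarith) Y hYG fun i hi _ => fin i ((hball i).trans ?_)
    by_cases hiv : i = v
    · rw [hiv, hG, ball2_delV_self]; simp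
    · have hsub : ball2 G i ⊆ (Aᶜ.erase v).erase i := by
        have hst : ∀ x y, x ∈ Aᶜ → G.Adj x y → y ∈ Aᶜ ∧ y ≠ v := by
          intro x y hx hxy
          rw [Finset.mem_compl] at *
          exact ⟨fun hy => hx ((hA _ _ hxy).mpr hy), hxy.2.2⟩
        intro k hk
        simp only [ball2, Finset.mem_filter, Finset.mem_univ, true_and] at hk
        rw [Finset.mem_erase, Finset.mem_erase]
        refine ⟨hk.1, ?_⟩
        rcases hk.2 with h | ⟨j, h1, h2⟩
        · exact (hst _ _ hi h).symm
        · exact (hst _ _ (hst _ _ hi h1).1 h2).symm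
      have h1 := Finset.card_le_card hsub
      have hv' : v ∈ Aᶜ := by simpa using hvA
      rw [Finset.card_erase_of_mem (Finset.mem_erase.mpr ⟨hiv, hi⟩),
        Finset.card_erase_of_mem hv', Finset.card_compl, hu, Fintype.card_fin] at h1
      omega

/-! ### Labels, isomorphisms and the lower bound -/

theorem iso_of_labels {V W : Type} [Fintype V] [Fintype W] (G : SimpleGraph V)
    (H : SimpleGraph W) (c : V → ℕ) (d : W → ℕ) (R : ℕ → ℕ → Prop)
    (hG : ∀ i j, G.Adj i j ↔ R (c i) (c j)) (hH : ∀ i j, H.Adj i j ↔ R (d i) (d j))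
    (hs : ∀ F : ℕ → ℕ, ∑ i, F (c i) = ∑ i, F (d i)) : Nonempty (G ≃g H) := by
  have hc : ∀ l, Nonempty ({i // c i = l} ≃ {i // d i = l}) := by
    intro l
    refine ⟨Fintype.equivOfCardEq ?_⟩
    have := hs (fun x => if x = l then 1 else 0)
    simp only [Finset.sum_boole, Nat.cast_id] at this
    rw [Fintype.card_subtype, Fintype.card_subtype]
    exact this
  let e : V ≃ W := (Equiv.sigmaFiberEquiv c).symm.trans
    ((Equiv.sigmaCongrRight fun l => (hc l).some).trans (Equiv.sigmaFiberEquiv d))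
  have he : ∀ i, d (e i) = c i := by
    intro i
    exact ((hc (c i)).some ⟨i, rfl⟩).2
  refine ⟨⟨e, ?_⟩⟩
  intro i j
  rw [hH, hG, he, he]

/-- Labels of `DC(k1,k2,3)`. -/
def lab3 (k1 i : ℕ) : ℕ := if i < 3 then i else if i < 3 + k1 then 3 else 4

/-- Label adjacency of `DC(k1,k2,3)`. -/
def R3 (x y : ℕ) : Prop :=
  (x = 0 ∧ y = 1) ∨ (x = 1 ∧ y = 0) ∨ (x = 1 ∧ y = 2) ∨ (x = 2 ∧ y = 1) ∨
  (x = 0 ∧ y = 3) ∨ (x = 3 ∧ y = 0) ∨ (x = 2 ∧ y = 4) ∨ (x = 4 ∧ y = 2)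

/-- Labels of `DC(k1,k2,4)`. -/
def lab4 (k1 i : ℕ) : ℕ := if i < 4 then i else if i < 4 + k1 then 4 else 5

/-- Label adjacency of `DC(k1,k2,4)`. -/
def R4 (x y : ℕ) : Prop :=
  (x = 0 ∧ y = 1) ∨ (x = 1 ∧ y = 0) ∨ (x = 1 ∧ y = 2) ∨ (x = 2 ∧ y = 1) ∨
  (x = 2 ∧ y = 3) ∨ (x = 3 ∧ y = 2) ∨
  (x = 0 ∧ y = 4) ∨ (x = 4 ∧ y = 0) ∨ (x = 3 ∧ y = 5) ∨ (x = 5 ∧ y = 3)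

theorem lab3_cases (k1 i : ℕ) : (i = 0 ∧ lab3 k1 i = 0) ∨ (i = 1 ∧ lab3 k1 i = 1) ∨ (i = 2 ∧ lab3 k1 i = 2) ∨
    (3 ≤ i ∧ i < 3 + k1 ∧ lab3 k1 i = 3) ∨ (3 + k1 ≤ i ∧ lab3 k1 i = 4) := by
  unfold lab3
  split_ifs <;> omega

theorem dc3_aux (k1 i j : ℕ) : (¬ i = j ∧
    ((i + 1 = j ∧ j < 3 ∨ 3 ≤ i ∧ i < 3 + k1 ∧ j = 0 ∨ 3 + k1 ≤ i ∧ j = 3 - 1) ∨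
      j + 1 = i ∧ i < 3 ∨ 3 ≤ j ∧ j < 3 + k1 ∧ i = 0 ∨ 3 + k1 ≤ j ∧ i = 3 - 1)) ↔
    R3 (lab3 k1 i) (lab3 k1 j) := by
  unfold R3
  rcases lab3_cases k1 i with ⟨h1, h2⟩|⟨h1, h2⟩|⟨h1, h2⟩|⟨h1, h1b, h2⟩|⟨h1, h2⟩ <;>
  rcases lab3_cases k1 j with ⟨g1, g2⟩|⟨g1, g2⟩|⟨g1, g2⟩|⟨g1, g1b, g2⟩|⟨g1, g2⟩ <;>
  rw [h2, g2] <;> omega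

theorem dc3_adj (k1 k2 : ℕ) (i j : Fin (k1 + k2 + 3)) :
    (doubleComet k1 k2 3).Adj i j ↔ R3 (lab3 k1 i) (lab3 k1 j) := by
  simp only [doubleComet, SimpleGraph.fromRel_adj, ne_eq, Fin.ext_iff]
  exact dc3_aux k1 i j

theorem lab4_cases (k1 i : ℕ) : (i = 0 ∧ lab4 k1 i = 0) ∨ (i = 1 ∧ lab4 k1 i = 1) ∨ (i = 2 ∧ lab4 k1 i = 2) ∨ (i = 3 ∧ lab4 k1 i = 3) ∨
    (4 ≤ i ∧ i < 4 + k1 ∧ lab4 k1 i = 4) ∨ (4 + k1 ≤ i ∧ lab4 k1 i = 5) := by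
  unfold lab4
  split_ifs <;> omega

set_option maxHeartbeats 2000000 in
theorem dc4_aux (k1 i j : ℕ) : (¬ i = j ∧
    ((i + 1 = j ∧ j < 4 ∨ 4 ≤ i ∧ i < 4 + k1 ∧ j = 0 ∨ 4 + k1 ≤ i ∧ j = 4 - 1) ∨
      j + 1 = i ∧ i < 4 ∨ 4 ≤ j ∧ j < 4 + k1 ∧ i = 0 ∨ 4 + k1 ≤ j ∧ i = 4 - 1)) ↔
    R4 (lab4 k1 i) (lab4 k1 j) := by
  unfold R4
  rcases lab4_cases k1 i with ⟨h1, h2⟩|⟨h1, h2⟩|⟨h1, h2⟩|⟨h1, h2⟩|⟨h1, h1b, h2⟩|⟨h1, h2⟩ <;>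
  rcases lab4_cases k1 j with ⟨g1, g2⟩|⟨g1, g2⟩|⟨g1, g2⟩|⟨g1, g2⟩|⟨g1, g1b, g2⟩|⟨g1, g2⟩ <;>
  rw [h2, g2] <;> omega

theorem dc4_adj (k1 k2 : ℕ) (i j : Fin (k1 + k2 + 4)) :
    (doubleComet k1 k2 4).Adj i j ↔ R4 (lab4 k1 i) (lab4 k1 j) := by
  simp only [doubleComet, SimpleGraph.fromRel_adj, ne_eq, Fin.ext_iff]
  exact dc4_aux k1 i j

theorem dc3_sum {M : Type} [AddCommMonoid M] (k1 k2 : ℕ) (F : ℕ → M) :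
    ∑ i : Fin (k1 + k2 + 3), F (lab3 k1 i) = F 0 + F 1 + F 2 + k1 • F 3 + k2 • F 4 := by
  rw [Fin.sum_univ_eq_sum_range (fun i => F (lab3 k1 i)),
    show k1 + k2 + 3 = 3 + k1 + k2 by ring, Finset.sum_range_add, Finset.sum_range_add]
  have h1 : ∑ x ∈ Finset.range k1, F (lab3 k1 (3 + x)) = k1 • F 3 := by
    rw [Finset.sum_congr rfl (g := fun _ => F 3), Finset.sum_const, Finset.card_range]
    intro x hx
    rw [Finset.mem_range] at hx
    simp [lab3, hx]
  have h2 : ∑ x ∈ Finset.range k2, F (lab3 k1 (3 + k1 + x)) = k2 • F 4 := by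
    rw [Finset.sum_congr rfl (g := fun _ => F 4), Finset.sum_const, Finset.card_range]
    intro x hx
    have h1 : ¬ (3 + k1 + x < 3) := by omega
    have h2 : ¬ (3 + k1 + x < 3 + k1) := by omega
    simp only [lab3, h1, h2, if_false]
  rw [h1, h2]
  simp [Finset.sum_range_succ, lab3]

theorem dc4_sum {M : Type} [AddCommMonoid M] (k1 k2 : ℕ) (F : ℕ → M) :
    ∑ i : Fin (k1 + k2 + 4), F (lab4 k1 i) = F 0 + F 1 + F 2 + F 3 + k1 • F 4 + k2 • F 5 := by
  rw [Fin.sum_univ_eq_sum_range (fun i => F (lab4 k1 i)),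
    show k1 + k2 + 4 = 4 + k1 + k2 by ring, Finset.sum_range_add, Finset.sum_range_add]
  have h1 : ∑ x ∈ Finset.range k1, F (lab4 k1 (4 + x)) = k1 • F 4 := by
    rw [Finset.sum_congr rfl (g := fun _ => F 4), Finset.sum_const, Finset.card_range]
    intro x hx
    rw [Finset.mem_range] at hx
    simp [lab4, hx]
  have h2 : ∑ x ∈ Finset.range k2, F (lab4 k1 (4 + k1 + x)) = k2 • F 5 := by
    rw [Finset.sum_congr rfl (g := fun _ => F 5), Finset.sum_const, Finset.card_range]
    intro x hx
    have h1 : ¬ (4 + k1 + x < 4) := by omega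
    have h2 : ¬ (4 + k1 + x < 4 + k1) := by omega
    simp only [lab4, h1, h2, if_false]
  rw [h1, h2]
  simp [Finset.sum_range_succ, lab4]

/-- Test vectors on labels. -/
noncomputable def xi (μ α β : ℝ) (l : ℕ) : ℝ :=
  if l = 0 then α else if l = 1 then (α + β) / μ else if l = 2 then β else
    if l = 3 then α / μ else β / μ

theorem lower_bound {n k : ℕ} (hn : 2 ≤ n) (T : SimpleGraph (Fin n))
    (h : Nonempty (T ≃g doubleComet k (k + 1) 3)) :
    √((k : ℝ) + (3 - √5) / 2) ≤ lam 2 T := by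
  obtain ⟨φ⟩ := h
  set t : ℝ := (k : ℝ) + (3 - √5) / 2 with ht
  have h5 : √5 * √5 = 5 := Real.mul_self_sqrt (by norm_num)
  have h5' : 0 ≤ √5 := Real.sqrt_nonneg 5
  have h53 : √5 < 3 := by nlinarith
  have h52 : 2 < √5 := by nlinarith
  have hk : (0 : ℝ) ≤ k := Nat.cast_nonneg k
  have htpos : 0 < t := by rw [ht]; linarith
  set μ := √t with hμd
  have hμ : 0 < μ := Real.sqrt_pos.mpr htpos
  have hμ2 : μ * μ = t := Real.mul_self_sqrt htpos.le
  let c : Fin n → ℕ := fun i => lab3 k (φ i)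
  have hadj : ∀ i j, T.Adj i j ↔ R3 (c i) (c j) := by
    intro i j
    rw [← dc3_adj, φ.map_adj_iff]
  have hsum : ∀ F : ℕ → ℝ, ∑ i, F (c i) = F 0 + F 1 + F 2 + k * F 3 + ((k : ℝ) + 1) * F 4 := by
    intro F
    have h1 : ∑ i, F (c i) = ∑ i : Fin (k + (k + 1) + 3), F (lab3 k i) :=
      Equiv.sum_comp φ.toEquiv (fun i : Fin (k + (k + 1) + 3) => F (lab3 k i))
    rw [h1, dc3_sum]
    simp
  have hnorm : ∀ α β, ∑ i, xi μ α β (c i) ^ 2 =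
      α ^ 2 + β ^ 2 + ((α + β) ^ 2 + k * α ^ 2 + (k + 1) * β ^ 2) / t := by
    intro α β
    rw [hsum (fun l => xi μ α β l ^ 2)]
    simp [xi]
    rw [← hμ2]
    field_simp
    ring
  have hq : ∀ α β, qf T (fun i => xi μ α β (c i)) =
      2 * ((α + β) ^ 2 + k * α ^ 2 + (k + 1) * β ^ 2) / μ := by
    intro α β
    unfold qf
    simp only [hadj]
    refine (hsum (fun l => ∑ j, (if R3 l (c j) then xi μ α β l * xi μ α β (c j) else 0))).trans ?_
    have h2 : ∀ l, ∑ j, (if R3 l (c j) then xi μ α β l * xi μ α β (c j) else 0) = _ :=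
      fun l => hsum (fun l' => if R3 l l' then xi μ α β l * xi μ α β l' else 0)
    simp only [h2]
    simp [R3, xi]
    field_simp
    ring
  refine le_lam hn T (fun α β i => xi μ α β (c i)) μ ?_ ?_ ?_
  · intro α β i
    simp only [xi]
    split_ifs <;> ring
  · intro α β hab
    rw [hnorm]
    have : 0 ≤ ((α + β) ^ 2 + k * α ^ 2 + (k + 1) * β ^ 2) / t := by positivity
    linarith
  · intro α β
    rw [hnorm, hq, le_div_iff₀ hμ]
    have e1 : μ * (α ^ 2 + β ^ 2 + ((α + β) ^ 2 + k * α ^ 2 + (k + 1) * β ^ 2) / t) * μ =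
        t * (α ^ 2 + β ^ 2) + ((α + β) ^ 2 + k * α ^ 2 + (k + 1) * β ^ 2) := by
      rw [mul_right_comm, hμ2]
      field_simp
    rw [e1, ht]
    have e2 : 0 ≤ (√5 - 1) / 2 * α ^ 2 + 2 * α * β + (√5 + 1) / 2 * β ^ 2 := by
      have : (√5 - 1) / 2 * α ^ 2 + 2 * α * β + (√5 + 1) / 2 * β ^ 2 =
          (√5 + 1) / 2 * ((√5 - 1) / 2 * α + β) ^ 2 := by
        linear_combination (-(√5 - 1) / 8 * α ^ 2 - α * β / 2) * h5
      rw [this]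
      positivity
    linarith

/-! ### Star cases -/

/-- Adjacency of two stars joined by an edge `uv`. -/
def StarAdj {n : ℕ} (T : SimpleGraph (Fin n)) (A : Finset (Fin n)) (a b u v : Fin n) : Prop :=
  ∀ x y, T.Adj x y ↔ (x = a ∧ y ∈ A ∧ y ≠ a) ∨ (y = a ∧ x ∈ A ∧ x ≠ a) ∨
    (x = b ∧ y ∉ A ∧ y ≠ b) ∨ (y = b ∧ x ∉ A ∧ x ≠ b) ∨ (x = u ∧ y = v) ∨ (x = v ∧ y = u)

theorem star_adj {n : ℕ} {T : SimpleGraph (Fin n)} (hT : T.IsTree) {u v a b : Fin n}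
    (huv : T.Adj u v) (ha : a ∈ side T u v) (hb : b ∈ side T v u)
    (hA : ∀ x ∈ side T u v, x ≠ a → T.Adj a x) (hB : ∀ x ∈ side T v u, x ≠ b → T.Adj b x) :
    StarAdj T (side T u v) a b u v := by
  obtain ⟨Y, hY⟩ := tree_color hT
  have hc : ∀ x, x ∈ side T v u ↔ x ∉ side T u v := by
    intro x; rw [side_compl hT huv, Finset.mem_compl]
  have tri : ∀ x y z, T.Adj z x → T.Adj z y → T.Adj x y → False := by
    intro x y z h1 h2 h3
    have := hY _ _ h1
    have := hY _ _ h2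
    have := hY _ _ h3
    tauto
  have hv : v ∉ side T u v := not_mem_side hT huv
  have cross : ∀ x y, T.Adj x y → x ∈ side T u v → y ∉ side T u v → x = u ∧ y = v := by
    intro x y h hx hy
    by_contra hne
    refine hy (side_step hx h ?_)
    intro he
    rcases Sym2.eq_iff.mp he with h1 | h1
    · exact hne h1
    · rw [h1.1] at hx; exact hv hx
  intro x y
  constructor
  · intro h
    by_cases hx : x ∈ side T u v <;> by_cases hy : y ∈ side T u v
    · by_cases hxa : x = a
      · left; exact ⟨hxa, hy, fun h' => h.ne (hxa.trans h'.symm)⟩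
      · by_cases hya : y = a
        · right; left; exact ⟨hya, hx, hxa⟩
        · exact (tri x y a (hA x hx hxa) (hA y hy hya) h).elim
    · have := cross x y h hx hy; tauto
    · have := cross y x h.symm hy hx; tauto
    · by_cases hxa : x = b
      · right; right; left; exact ⟨hxa, hy, fun h' => h.ne (hxa.trans h'.symm)⟩
      · by_cases hya : y = b
        · right; right; right; left; exact ⟨hya, hx, hxa⟩
        · exact (tri x y b (hB x ((hc x).2 hx) hxa) (hB y ((hc y).2 hy) hya) h).elim
  · rintro (⟨rfl, h1, h2⟩ | ⟨rfl, h1, h2⟩ | ⟨rfl, h1, h2⟩ | ⟨rfl, h1, h2⟩ | ⟨rfl, rfl⟩ | ⟨rfl, rfl⟩)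
    · exact hA _ h1 h2
    · exact (hA _ h1 h2).symm
    · exact hB _ ((hc _).2 h1) h2
    · exact (hB _ ((hc _).2 h1) h2).symm
    · exact huv
    · exact huv.symm

theorem sum_ite_mem_ne {n : ℕ} (A : Finset (Fin n)) {a : Fin n} (ha : a ∈ A) (c : ℝ) :
    (∑ j, if j ∈ A ∧ j ≠ a then c else 0) = ((A.card : ℝ) - 1) * c := by
  rw [← Finset.sum_filter, Finset.sum_const, nsmul_eq_mul]
  have : Finset.univ.filter (fun j => j ∈ A ∧ j ≠ a) = A.erase a := by
    ext j; simp [and_comm]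
  rw [this, Finset.card_erase_of_mem ha, Nat.cast_sub (Finset.card_pos.mpr ⟨a, ha⟩)]
  simp

theorem star_centers {n m : ℕ} (hm : 6 ≤ m) (hn : 2 ≤ n) {T : SimpleGraph (Fin n)}
    {A : Finset (Fin n)} {a b : Fin n} (ha : a ∈ A) (hb : b ∉ A) (hA : A.card = m)
    (hB : Aᶜ.card = m) (hadj : StarAdj T A a b a b) : lam 2 T ≤ √((m : ℝ) - 2) := by
  have hm' : (6 : ℝ) ≤ m := by exact_mod_cast hm
  set μ := √((m : ℝ) - 2) with hμd
  have hμ2 : μ * μ = (m : ℝ) - 2 := Real.mul_self_sqrt (by linarith)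
  have hμ1 : 1 ≤ μ := by
    have : 0 ≤ μ := Real.sqrt_nonneg _
    nlinarith
  have hμ : 0 < μ := by linarith
  have hab : a ≠ b := by rintro rfl; exact hb ha
  have hb' : b ∈ Aᶜ := Finset.mem_compl.mpr hb
  have hR : ((m : ℝ) - 1) * (1 / μ) - 1 ≤ μ := by
    have : ((m : ℝ) - 1) * (1 / μ) = μ + 1 / μ := by
      field_simp; nlinarith
    have h1 : 1 / μ ≤ 1 := by rw [div_le_one hμ]; exact hμ1
    linarith
  refine lam_le hn T (fun i => (if i = a then 1 else 0) + (if i = b then 1 else 0)) μ ?_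
  intro x hx
  have hxab : x a + x b = 0 := by
    simpa [add_mul, Finset.sum_add_distrib] using hx
  refine (qf_le_weights T (fun i j => if i = a then (if j = b then -1 else 1 / μ) else
    if i = b then (if j = a then -1 else 1 / μ) else μ) x ?_).trans ?_
  · intro i j hij
    have hb1 : x b = - x a := by linarith
    have w1 : ∀ p q : ℝ, 2 * (p * q) ≤ 1 / μ * p ^ 2 + μ * q ^ 2 := fun p q =>
      two_mul_le_of_weights (by positivity) (by field_simp)
    have w2 : ∀ p q : ℝ, 2 * (p * q) ≤ μ * p ^ 2 + 1 / μ * q ^ 2 := fun p q =>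
      two_mul_le_of_weights (by positivity) (by field_simp)
    have hba := hab.symm
    rcases (hadj i j).1 hij with ⟨rfl, h1, h2⟩ | ⟨rfl, h1, h2⟩ | ⟨rfl, h1, h2⟩ | ⟨rfl, h1, h2⟩ |
      ⟨rfl, rfl⟩ | ⟨rfl, rfl⟩
    · have : j ≠ b := by rintro rfl; exact hb h1
      simp only [if_true, this, h2, if_false]; exact w1 _ _
    · have : i ≠ b := by rintro rfl; exact hb h1
      simp only [if_true, this, h2, if_false]; exact w2 _ _
    · have : j ≠ a := by rintro rfl; exact h1 ha
      simp only [if_true, this, h2, hba, if_false]; exact w1 _ _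
    · have : i ≠ a := by rintro rfl; exact h1 ha
      simp only [if_true, this, h2, hba, if_false]; exact w2 _ _
    · simp only [if_true, hba, if_false, hb1]; nlinarith
    · simp only [if_true, hba, if_false, hb1]; nlinarith
  · rw [Finset.mul_sum]
    refine Finset.sum_le_sum fun i _ => ?_
    refine mul_le_mul_of_nonneg_right ?_ (sq_nonneg _)
    by_cases hia : i = a
    · subst hia
      have : ∀ j, (if T.Adj i j then (if i = i then (if j = b then -1 else 1 / μ) else
          if i = b then (if j = i then -1 else 1 / μ) else μ) else 0) =
          (if j ∈ A ∧ j ≠ i then 1 / μ else 0) + (if j = b then -1 else 0) := by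
        intro j
        by_cases hj : j = b
        · subst hj
          have : T.Adj i j := (hadj _ _).2 (by tauto)
          simp [this, hb]
        · have : T.Adj i j ↔ (j ∈ A ∧ j ≠ i) := by
            rw [hadj]; grind
          simp [this, hj]
      rw [Finset.sum_congr rfl fun j _ => this j, Finset.sum_add_distrib, sum_ite_mem_ne A ha, hA]
      simpa using hR
    by_cases hib : i = b
    · subst hib
      have : ∀ j, (if T.Adj i j then (if i = a then (if j = i then -1 else 1 / μ) else
          if i = i then (if j = a then -1 else 1 / μ) else μ) else 0) =
          (if j ∈ Aᶜ ∧ j ≠ i then 1 / μ else 0) + (if j = a then -1 else 0) := by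
        intro j
        by_cases hj : j = a
        · subst hj
          have : T.Adj i j := (hadj _ _).2 (by tauto)
          simp [this, ha, hia]
        · have : T.Adj i j ↔ (j ∈ Aᶜ ∧ j ≠ i) := by
            rw [hadj, Finset.mem_compl]; grind
          simp [this, hj, hia]
      rw [Finset.sum_congr rfl fun j _ => this j, Finset.sum_add_distrib, sum_ite_mem_ne _ hb', hB]
      simpa using hR
    · simp only [hia, hib, if_false]
      by_cases hi : i ∈ A
      · have : ∀ j, T.Adj i j ↔ j = a := by
          intro j; rw [hadj]; grind
        simp [this]
      · have : ∀ j, T.Adj i j ↔ j = b := by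
          intro j; rw [hadj]; grind
        simp [this]

theorem star_dc3_upper {n m : ℕ} (hm : 6 ≤ m) (hn : 2 ≤ n) {T : SimpleGraph (Fin n)}
    {A : Finset (Fin n)} {a b u : Fin n} (ha : a ∈ A) (hb : b ∉ A) (hu : u ∈ A) (hua : u ≠ a)
    (hA : A.card = m)
    (hB : Aᶜ.card = m) (hadj : StarAdj T A a b u b) :
    lam 2 T ≤ √((m : ℝ) - 2 + (3 - √5) / 2) := by
  have hm' : (6 : ℝ) ≤ m := by exact_mod_cast hm
  have h5 : √5 * √5 = 5 := Real.mul_self_sqrt (by norm_num)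
  have h5' : 0 ≤ √5 := Real.sqrt_nonneg 5
  have h53 : √5 < 3 := by nlinarith
  obtain ⟨s, hs⟩ : ∃ s, s = (3 - √5) / 2 := ⟨_, rfl⟩
  rw [← hs]
  have hs2 : s * s = 3 * s - 1 := by rw [hs]; linear_combination h5 / 4
  have hs0 : 0 < s := by rw [hs]; linarith
  set μ := √((m : ℝ) - 2 + s) with hμd
  have hμ2 : μ * μ = (m : ℝ) - 2 + s := Real.mul_self_sqrt (by linarith)
  have hμ : 0 < μ := Real.sqrt_pos.mpr (by linarith)
  have hab : a ≠ b := by rintro rfl; exact hb ha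
  have hba := hab.symm
  have hub : u ≠ b := by rintro rfl; exact hb hu
  have hb' : b ∈ Aᶜ := Finset.mem_compl.mpr hb
  refine lam_le hn T (fun i => (if i = a then 1 - s else 0) + (if i = b then 1 else 0)) μ ?_
  intro x hx
  have hxab : (1 - s) * x a + x b = 0 := by
    simpa [add_mul, Finset.sum_add_distrib] using hx
  have hun : ∑ j, (if T.Adj u j then x j else 0) = x a + x b := by
    have : ∀ j, (if T.Adj u j then x j else 0) =
        (if j = a then x j else 0) + (if j = b then x j else 0) := by
      intro j
      have : T.Adj u j ↔ (j = a ∨ j = b) := by rw [hadj]; grind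
      by_cases h1 : j = a
      · rw [if_pos (this.2 (Or.inl h1)), if_pos h1, if_neg (by rw [h1]; exact hab), add_zero]
      · simp [this, h1]
    rw [Finset.sum_congr rfl fun j _ => this j, Finset.sum_add_distrib]
    simp
  rw [qf_delV T u x, hun]
  have hmain : qf (delV T u) x ≤ ∑ i, (μ - (if i = u then μ else 0) - (if i = a then s / μ else 0)
      - (if i = b then (s - 1) / μ else 0)) * x i ^ 2 := by
    refine (qf_le_weights (delV T u) (fun i _ => if i = a ∨ i = b then 1 / μ else μ) x ?_).trans ?_
    · intro i j hij
      have w1 : ∀ p q : ℝ, 2 * (p * q) ≤ 1 / μ * p ^ 2 + μ * q ^ 2 := fun p q =>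
        two_mul_le_of_weights (by positivity) (by field_simp)
      have w2 : ∀ p q : ℝ, 2 * (p * q) ≤ μ * p ^ 2 + 1 / μ * q ^ 2 := fun p q =>
        two_mul_le_of_weights (by positivity) (by field_simp)
      have hij' : T.Adj i j ∧ i ≠ u ∧ j ≠ u := hij
      have key : ((i = a ∨ i = b) ∧ ¬ (j = a ∨ j = b)) ∨ (¬ (i = a ∨ i = b) ∧ (j = a ∨ j = b)) := by
        have := (hadj i j).1 hij'.1
        grind
      rcases key with ⟨h1, h2⟩ | ⟨h1, h2⟩
      · simp only [h1, h2, if_true, if_false]; exact w1 _ _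
      · simp only [h1, h2, if_true, if_false]; exact w2 _ _
    · refine Finset.sum_le_sum fun i _ => ?_
      refine mul_le_mul_of_nonneg_right ?_ (sq_nonneg _)
      by_cases hiu : i = u
      · subst hiu
        have : ∀ j, ¬ (delV T i).Adj i j := fun j h => h.2.1 rfl
        simp [this, hua, hub]
      by_cases hia : i = a
      · subst hia
        have : ∀ j, (if (delV T u).Adj i j then (if i = i ∨ i = b then 1 / μ else μ) else 0) =
            (if j ∈ A ∧ j ≠ i then 1 / μ else 0) - (if j = u then 1 / μ else 0) := by
          intro j
          by_cases hj : j = u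
          · subst hj
            have : ¬ (delV T j).Adj i j := fun h => h.2.2 rfl
            simp [this, hu, hua]
          · have : (delV T u).Adj i j ↔ (j ∈ A ∧ j ≠ i) := by
              change (T.Adj i j ∧ i ≠ u ∧ j ≠ u) ↔ _
              rw [hadj]; grind
            simp [this, hj]
        rw [Finset.sum_congr rfl fun j _ => this j, Finset.sum_sub_distrib, sum_ite_mem_ne A ha, hA]
        simp only [hiu, hab, Finset.sum_ite_eq', Finset.mem_univ, if_true, if_false]
        apply le_of_eq
        field_simp
        nlinarith
      by_cases hib : i = b
      · subst hib
        have : ∀ j, (if (delV T u).Adj i j then (if i = a ∨ i = i then 1 / μ else μ) else 0) =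
            (if j ∈ Aᶜ ∧ j ≠ i then 1 / μ else 0) := by
          intro j
          have : (delV T u).Adj i j ↔ (j ∈ Aᶜ ∧ j ≠ i) := by
            change (T.Adj i j ∧ i ≠ u ∧ j ≠ u) ↔ _
            rw [hadj, Finset.mem_compl]; grind
          simp [this]
        rw [Finset.sum_congr rfl fun j _ => this j, sum_ite_mem_ne _ hb', hB]
        simp only [hiu, hba, if_true, if_false]
        apply le_of_eq
        field_simp
        nlinarith
      · simp only [hiu, hia, hib, if_false, or_self]
        by_cases hi : i ∈ A
        · have : ∀ j, (delV T u).Adj i j ↔ j = a := by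
            intro j
            change (T.Adj i j ∧ i ≠ u ∧ j ≠ u) ↔ _
            rw [hadj]; grind
          simp [this]
        · have : ∀ j, (delV T u).Adj i j ↔ j = b := by
            intro j
            change (T.Adj i j ∧ i ≠ u ∧ j ≠ u) ↔ _
            rw [hadj]; grind
          simp [this]
  have hexp : ∑ i, (μ - (if i = u then μ else 0) - (if i = a then s / μ else 0)
      - (if i = b then (s - 1) / μ else 0)) * x i ^ 2 =
      μ * ∑ i, x i ^ 2 - μ * x u ^ 2 - s / μ * x a ^ 2 - (s - 1) / μ * x b ^ 2 := by
    simp [sub_mul, Finset.sum_sub_distrib, Finset.mul_sum]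
  rw [hexp] at hmain
  have hb1 : x b = - (1 - s) * x a := by linarith
  have hfin : μ * x u ^ 2 + s / μ * x a ^ 2 + (s - 1) / μ * x b ^ 2 - 2 * x u * (x a + x b) =
      (μ * x u - s * x a) ^ 2 / μ := by
    rw [hb1]
    field_simp
    linear_combination (x a ^ 2 * (s - 1)) * hs2
  have : 0 ≤ (μ * x u - s * x a) ^ 2 / μ := by positivity
  linarith

theorem star_dc3_iso {n m : ℕ} (hm : 6 ≤ m) {T : SimpleGraph (Fin n)}
    {A : Finset (Fin n)} {a b u : Fin n} (ha : a ∈ A) (hb : b ∉ A) (hu : u ∈ A) (hua : u ≠ a)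
    (hA : A.card = m)
    (hB : Aᶜ.card = m) (hadj : StarAdj T A a b u b) :
    Nonempty (T ≃g doubleComet (m - 2) (m - 1) 3) := by
  have hab : a ≠ b := by rintro rfl; exact hb ha
  have hub : u ≠ b := by rintro rfl; exact hb hu
  obtain ⟨c, hc⟩ : ∃ c : Fin n → ℕ, c = fun i => if i = a then 0 else if i = u then 1 else
    if i = b then 2 else if i ∈ A then 3 else 4 := ⟨_, rfl⟩
  have hcc : ∀ i, (i = a ∧ c i = 0) ∨ (i = u ∧ c i = 1) ∨ (i = b ∧ c i = 2) ∨
      (i ≠ a ∧ i ≠ u ∧ i ≠ b ∧ i ∈ A ∧ c i = 3) ∨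
      (i ≠ a ∧ i ≠ u ∧ i ≠ b ∧ i ∉ A ∧ c i = 4) := by
    intro i
    rw [hc]
    dsimp only
    split_ifs <;> tauto
  refine iso_of_labels T _ c (fun i => lab3 (m - 2) i) R3 ?_ (dc3_adj _ _) ?_
  · intro i j
    rw [hadj]
    unfold R3
    rcases hcc i with ⟨h1, h2⟩ | ⟨h1, h2⟩ | ⟨h1, h2⟩ | ⟨h1, h1p, h1q, h1A, h2⟩ |
      ⟨h1, h1p, h1q, h1A, h2⟩ <;>
    rcases hcc j with ⟨g1, g2⟩ | ⟨g1, g2⟩ | ⟨g1, g2⟩ | ⟨g1, g1p, g1q, g1A, g2⟩ |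
      ⟨g1, g1p, g1q, g1A, g2⟩ <;>
    rw [h2, g2] <;> norm_num <;> grind
  · intro F
    rw [dc3_sum, ← Finset.sum_add_sum_compl A]
    have hau : a ∈ A.erase u := Finset.mem_erase.mpr ⟨hua.symm, ha⟩
    rw [← Finset.add_sum_erase A _ hu, ← Finset.add_sum_erase _ _ hau,
      ← Finset.add_sum_erase Aᶜ _ (Finset.mem_compl.mpr hb)]
    have e1 : ∑ x ∈ (A.erase u).erase a, F (c x) = (m - 2) • F 3 := by
      rw [Finset.sum_congr rfl (g := fun _ => F 3), Finset.sum_const,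
        Finset.card_erase_of_mem hau, Finset.card_erase_of_mem hu, hA]
      · rfl
      · intro x hx
        simp only [Finset.mem_erase] at hx
        congr 1
        have := hcc x
        grind
    have e2 : ∑ x ∈ Aᶜ.erase b, F (c x) = (m - 1) • F 4 := by
      rw [Finset.sum_congr rfl (g := fun _ => F 4), Finset.sum_const,
        Finset.card_erase_of_mem (Finset.mem_compl.mpr hb), hB]
      · intro x hx
        simp only [Finset.mem_erase, Finset.mem_compl] at hx
        congr 1
        have := hcc x
        grind
    have c1 : c a = 0 := by simp [hc]
    have c2 : c u = 1 := by simp [hc, hua]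
    have c3 : c b = 2 := by simp [hc, hab.symm, hub.symm]
    rw [e1, e2, c1, c2, c3]
    ring

set_option maxHeartbeats 4000000 in
theorem star_dc4_iso {n m : ℕ} (hm : 6 ≤ m) {T : SimpleGraph (Fin n)}
    {A : Finset (Fin n)} {a b u v : Fin n} (ha : a ∈ A) (hb : b ∉ A) (hu : u ∈ A) (hua : u ≠ a)
    (hv : v ∉ A) (hvb : v ≠ b) (hA : A.card = m)
    (hB : Aᶜ.card = m) (hadj : StarAdj T A a b u v) :
    Nonempty (T ≃g doubleComet (m - 2) (m - 2) 4) := by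
  have hab : a ≠ b := by rintro rfl; exact hb ha
  have hub : u ≠ b := by rintro rfl; exact hb hu
  have hva : v ≠ a := by rintro rfl; exact hv ha
  have hvu : v ≠ u := by rintro rfl; exact hv hu
  obtain ⟨c, hc⟩ : ∃ c : Fin n → ℕ, c = fun i => if i = a then 0 else if i = u then 1 else
    if i = v then 2 else if i = b then 3 else if i ∈ A then 4 else 5 := ⟨_, rfl⟩
  have hcc : ∀ i, (i = a ∧ c i = 0) ∨ (i = u ∧ c i = 1) ∨ (i = v ∧ c i = 2) ∨ (i = b ∧ c i = 3) ∨
      (i ≠ a ∧ i ≠ u ∧ i ≠ v ∧ i ≠ b ∧ i ∈ A ∧ c i = 4) ∨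
      (i ≠ a ∧ i ≠ u ∧ i ≠ v ∧ i ≠ b ∧ i ∉ A ∧ c i = 5) := by
    intro i
    rw [hc]
    dsimp only
    split_ifs <;> tauto
  refine iso_of_labels T _ c (fun i => lab4 (m - 2) i) R4 ?_ (dc4_adj _ _) ?_
  · intro i j
    rw [hadj]
    unfold R4
    rcases hcc i with ⟨h1, h2⟩ | ⟨h1, h2⟩ | ⟨h1, h2⟩ | ⟨h1, h2⟩ | ⟨h1, h1p, h1v, h1q, h1A, h2⟩ |
      ⟨h1, h1p, h1v, h1q, h1A, h2⟩ <;>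
    rcases hcc j with ⟨g1, g2⟩ | ⟨g1, g2⟩ | ⟨g1, g2⟩ | ⟨g1, g2⟩ | ⟨g1, g1p, g1v, g1q, g1A, g2⟩ |
      ⟨g1, g1p, g1v, g1q, g1A, g2⟩ <;>
    rw [h2, g2] <;> norm_num <;> grind
  · intro F
    rw [dc4_sum, ← Finset.sum_add_sum_compl A]
    have hau : a ∈ A.erase u := Finset.mem_erase.mpr ⟨hua.symm, ha⟩
    have hbc : b ∈ Aᶜ := Finset.mem_compl.mpr hb
    have hvbc : v ∈ Aᶜ.erase b := Finset.mem_erase.mpr ⟨hvb, Finset.mem_compl.mpr hv⟩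
    rw [← Finset.add_sum_erase A _ hu, ← Finset.add_sum_erase _ _ hau,
      ← Finset.add_sum_erase Aᶜ _ hbc, ← Finset.add_sum_erase _ _ hvbc]
    have e1 : ∑ x ∈ (A.erase u).erase a, F (c x) = (m - 2) • F 4 := by
      rw [Finset.sum_congr rfl (g := fun _ => F 4), Finset.sum_const,
        Finset.card_erase_of_mem hau, Finset.card_erase_of_mem hu, hA]
      · rfl
      · intro x hx
        simp only [Finset.mem_erase] at hx
        congr 1
        have := hcc x
        grind
    have e2 : ∑ x ∈ (Aᶜ.erase b).erase v, F (c x) = (m - 2) • F 5 := by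
      rw [Finset.sum_congr rfl (g := fun _ => F 5), Finset.sum_const,
        Finset.card_erase_of_mem hvbc, Finset.card_erase_of_mem hbc, hB]
      · rfl
      · intro x hx
        simp only [Finset.mem_erase, Finset.mem_compl] at hx
        congr 1
        have := hcc x
        grind
    have c1 : c a = 0 := by simp [hc]
    have c2 : c u = 1 := by simp [hc, hua]
    have c3 : c b = 3 := by simp [hc, hab.symm, hub.symm, hvb.symm]
    have c4 : c v = 2 := by simp [hc, hva, hvu]
    rw [e1, e2, c1, c2, c3, c4]
    ring

/-- Swapping the two sides. -/
theorem StarAdj.swap {n : ℕ} {T : SimpleGraph (Fin n)} {A : Finset (Fin n)} {a b u v : Fin n}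
    (h : StarAdj T A a b u v) : StarAdj T Aᶜ b a v u := by
  intro x y
  rw [h x y]
  simp only [Finset.mem_compl, not_not]
  tauto

theorem dichotomy {n m : ℕ} (hn : n = 2 * m) (hm : 6 ≤ m) {T : SimpleGraph (Fin n)}
    (hT : T.IsTree) (hiso : ¬ Nonempty (T ≃g doubleComet (m - 2) (m - 2) 4)) :
    lam 2 T ≤ √((m : ℝ) - 5 / 3) ∨ (lam 2 T ≤ √((m : ℝ) - 2 + (3 - √5) / 2) ∧
      Nonempty (T ≃g doubleComet (m - 2) (m - 1) 3)) := by
  have hle : √((m : ℝ) - 2) ≤ √((m : ℝ) - 5 / 3) := Real.sqrt_le_sqrt (by linarith)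
  have hn2 : 2 ≤ n := by omega
  rcases centroid hn (by omega) hT with ⟨v, hv⟩ | ⟨u, v, huv, hu, hv⟩
  · exact Or.inl ((centroid_case hn hm hT hv).trans hle)
  by_cases hns : ∀ a ∈ side T u v, ∃ x ∈ side T u v, x ≠ a ∧ ¬ T.Adj a x
  · exact Or.inl (nonstar_case hn hm hT huv hu hns)
  by_cases hns' : ∀ a ∈ side T v u, ∃ x ∈ side T v u, x ≠ a ∧ ¬ T.Adj a x
  · exact Or.inl (nonstar_case hn hm hT huv.symm hv hns')
  push Not at hns hns'
  obtain ⟨a, ha, hA⟩ := hns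
  obtain ⟨b, hb, hB⟩ := hns'
  have hadj := star_adj hT huv ha hb hA hB
  have hu' : u ∈ side T u v := mem_side_self ..
  have hv' : v ∉ side T u v := not_mem_side hT huv
  rw [side_compl hT huv] at hv hb
  have hcc : (side T u v)ᶜᶜ.card = m := by rw [compl_compl]; exact hu
  have hb' := Finset.mem_compl.mp hb
  have hac : a ∉ (side T u v)ᶜ := by simpa using ha
  by_cases hua : u = a
  · by_cases hvb : v = b
    · rw [hua, hvb] at hadj
      subst hua hvb
      exact Or.inl ((star_centers hm hn2 ha hb' hu hv hadj).trans hle)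
    · have hadj' := hadj.swap
      subst hua
      right
      exact ⟨star_dc3_upper hm hn2 hb hac (Finset.mem_compl.mpr hv') hvb hv hcc hadj',
        star_dc3_iso hm hb hac (Finset.mem_compl.mpr hv') hvb hv hcc hadj'⟩
  · by_cases hvb : v = b
    · subst hvb
      right
      exact ⟨star_dc3_upper hm hn2 ha hb' hu' hua hu hv hadj,
        star_dc3_iso hm ha hb' hu' hua hu hv hadj⟩
    · exact (hiso (star_dc4_iso hm ha hb' hu' hua hv' hvb hu hv hadj)).elim

/-- For even `n ≥ 12`, among trees on `n` vertices other than `DC((n-4)/2, (n-4)/2, 4)`,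
one has `λ₂(T) ≤ √((n-1-√5)/2)`, with equality iff `T ≅ DC((n-4)/2, (n-2)/2, 3)`. -/
theorem second_max_lambda_two_even (n : ℕ) (hn : 12 ≤ n) (heven : Even n)
    (T : SimpleGraph (Fin n)) (hT : T.IsTree)
    (hiso : ¬ Nonempty (T ≃g doubleComet ((n - 4) / 2) ((n - 4) / 2) 4)) :
    lam 2 T ≤ Real.sqrt (((n : ℝ) - 1 - Real.sqrt 5) / 2) ∧
      (lam 2 T = Real.sqrt (((n : ℝ) - 1 - Real.sqrt 5) / 2) ↔
        Nonempty (T ≃g doubleComet ((n - 4) / 2) ((n - 2) / 2) 3)) := by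
  obtain ⟨m, hm⟩ := heven
  have hn2 : n = 2 * m := by omega
  have hm6 : 6 ≤ m := by omega
  have hm6' : (6 : ℝ) ≤ m := by exact_mod_cast hm6
  rw [show (n - 4) / 2 = m - 2 by omega] at hiso ⊢
  rw [show (n - 2) / 2 = m - 1 by omega]
  have hnr : (n : ℝ) = 2 * m := by exact_mod_cast hn2
  have ht : ((n : ℝ) - 1 - √5) / 2 = (m : ℝ) - 2 + (3 - √5) / 2 := by rw [hnr]; ring
  rw [ht]
  have h5 : √5 * √5 = 5 := Real.mul_self_sqrt (by norm_num)
  have h5' : 0 ≤ √5 := Real.sqrt_nonneg 5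
  have h57 : √5 < 7 / 3 := by nlinarith
  have hlt : √((m : ℝ) - 5 / 3) < √((m : ℝ) - 2 + (3 - √5) / 2) :=
    Real.sqrt_lt_sqrt (by linarith) (by linarith)
  have hlow : Nonempty (T ≃g doubleComet (m - 2) (m - 1) 3) →
      √((m : ℝ) - 2 + (3 - √5) / 2) ≤ lam 2 T := by
    intro h
    rw [show m - 1 = (m - 2) + 1 by omega] at h
    have := lower_bound (by omega) T h
    rwa [Nat.cast_sub (by omega), Nat.cast_ofNat] at this
  rcases dichotomy hn2 hm6 hT hiso with h | ⟨h1, h2⟩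
  · have h' := h.trans_lt hlt
    exact ⟨h'.le, fun he => absurd he h'.ne, fun hi => absurd (hlow hi) (not_le.mpr h')⟩
  · exact ⟨h1, fun _ => h2, fun hi => le_antisymm h1 (hlow hi)⟩
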